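/- arXiv:2412.06579 — 2 statements merged into one kernel-verified Lean document; each statement's English description precedes it below -/
import Mathlib

section
/- Let F ⊂ ℝ^d be a compact set with Assouad dimension η. Then every microset A of F satisfies dim_H A ≤ η, and moreover there exists a weak tangent E of F whose η-dimensional Hausdorff content is at least 1 (in particular dim_H E = dim_A E = η). -/
open Filter

/-- The smallest number of open balls of radius `r` needed to cover `E`. -/
noncomputable def coverNum {α : Type*} [PseudoMetricSpace α] (r : ℝ) (E : Set α) : ℕ :=
  sInf {n : ℕ | ∃ S : Finset α, S.card = n ∧ E ⊆ ⋃ x ∈ S, Metric.ball x r}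

/-- The Assouad dimension of a bounded set. -/
noncomputable def assouadDim {α : Type*} [PseudoMetricSpace α] (F : Set α) : ℝ :=
  sInf {s : ℝ | 0 ≤ s ∧ ∃ C : ℝ, 0 < C ∧ ∀ x ∈ F, ∀ r R : ℝ, 0 < r → r ≤ R → R ≤ 1 →
    (coverNum r (F ∩ Metric.ball x R) : ℝ) ≤ C * (R / r) ^ s}

/-- `A` is a microset of `F`: a Hausdorff-metric limit of sets `r_n⁻¹(F - x_n) ∩ B(0,1)`
with `x_n ∈ F` and `0 < r_n ≤ 1`. -/
def IsMicroset {d : ℕ} (F A : Set (EuclideanSpace ℝ (Fin d))) : Prop :=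
  IsCompact A ∧ A.Nonempty ∧ ∃ (x : ℕ → EuclideanSpace ℝ (Fin d)) (r : ℕ → ℝ),
    (∀ n, x n ∈ F) ∧ (∀ n, 0 < r n) ∧ (∀ n, r n ≤ 1) ∧
    Tendsto (fun n => Metric.hausdorffDist
        ((fun y => (r n)⁻¹ • (y - x n)) '' F ∩ Metric.closedBall 0 1) A)
      atTop (nhds 0)

/-- `E` is a weak tangent of `F`: a microset where moreover `r_n → 0`. -/
def IsWeakTangent {d : ℕ} (F E : Set (EuclideanSpace ℝ (Fin d))) : Prop :=
  IsCompact E ∧ E.Nonempty ∧ ∃ (x : ℕ → EuclideanSpace ℝ (Fin d)) (r : ℕ → ℝ),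
    (∀ n, x n ∈ F) ∧ (∀ n, 0 < r n) ∧ (∀ n, r n ≤ 1) ∧
    Tendsto r atTop (nhds 0) ∧
    Tendsto (fun n => Metric.hausdorffDist
        ((fun y => (r n)⁻¹ • (y - x n)) '' F ∩ Metric.closedBall 0 1) E)
      atTop (nhds 0)

/-- The `s`-dimensional Hausdorff content of a set. -/
noncomputable def hausdorffContent {α : Type*} [PseudoMetricSpace α] (s : ℝ) (E : Set α) :
    ENNReal :=
  ⨅ (U : ℕ → Set α) (_ : E ⊆ ⋃ n, U n), ∑' n, EMetric.diam (U n) ^ s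

namespace MicroAux

/-- `F ∩ closedBall x r` has a controlled cover by smaller balls. -/
def GoodCover {α : Type} [PseudoMetricSpace α] (F : Set α) (s c θ : ℝ) (x : α) (r : ℝ) : Prop :=
  ∃ (ι : Type) (t : Finset ι) (y : ι → α) (u : ι → ℝ),
    (∀ i ∈ t, y i ∈ F ∧ c * r ≤ u i ∧ u i ≤ θ * r) ∧
    F ∩ Metric.closedBall x r ⊆ ⋃ i ∈ t, Metric.closedBall (y i) (u i) ∧
    ∑ i ∈ t, u i ^ s ≤ r ^ s

def AssouadSet {α : Type*} [PseudoMetricSpace α] (F : Set α) : Set ℝ :=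
  {s : ℝ | 0 ≤ s ∧ ∃ C : ℝ, 0 < C ∧ ∀ x ∈ F, ∀ r R : ℝ, 0 < r → r ≤ R → R ≤ 1 →
    (coverNum r (F ∩ Metric.ball x R) : ℝ) ≤ C * (R / r) ^ s}

lemma coverNum_le {α : Type*} [PseudoMetricSpace α] {r : ℝ} {E : Set α} (S : Finset α)
    (h : E ⊆ ⋃ x ∈ S, Metric.ball x r) : coverNum r E ≤ S.card :=
  Nat.sInf_le ⟨S, rfl, h⟩

lemma iter_cover {α : Type} [PseudoMetricSpace α] (F : Set α) (s c θ δ ρ : ℝ)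
    (hs : 0 ≤ s) (hc : 0 < c) (hθ0 : 0 < θ) (hρ : 0 < ρ) (hθ1 : θ < 1)
    (H : ∀ x ∈ F, ∀ r, 0 < r → r ≤ δ → GoodCover F s c θ x r) (k : ℕ) :
    ∀ x ∈ F, ∀ r, c * ρ ≤ r → r ≤ δ → r * θ ^ k ≤ ρ →
      ∃ S : Finset α, (S.card : ℝ) ≤ (r / (c * ρ)) ^ s ∧
        F ∩ Metric.closedBall x r ⊆ ⋃ y ∈ S, Metric.closedBall y ρ := by
  classical
  have hcρ : 0 < c * ρ := mul_pos hc hρ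
  have base : ∀ x ∈ F, ∀ r, c * ρ ≤ r → r ≤ ρ → 
      ∃ S : Finset α, (S.card : ℝ) ≤ (r / (c * ρ)) ^ s ∧
        F ∩ Metric.closedBall x r ⊆ ⋃ y ∈ S, Metric.closedBall y ρ := by
    intro x hx r h1 h2
    refine ⟨{x}, ?_, ?_⟩
    · simp only [Finset.card_singleton, Nat.cast_one]
      exact Real.one_le_rpow ((one_le_div hcρ).2 h1) hs
    · intro z hz
      simp only [Finset.mem_singleton, Set.iUnion_iUnion_eq_left]
      exact Metric.closedBall_subset_closedBall h2 hz.2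
  induction k with
  | zero => intro x hx r h1 h2 h3; exact base x hx r h1 (by simpa using h3)
  | succ k ih =>
    intro x hx r h1 h2 h3
    by_cases hr : r ≤ ρ
    · exact base x hx r h1 hr
    push Not at hr
    have hr0 : 0 < r := hρ.trans hr
    obtain ⟨ι, t, y, u, hu, hcov, hsum⟩ := H x hx r hr0 h2
    have hloc : ∀ i ∈ t, ∃ S : Finset α, (S.card : ℝ) ≤ (u i / (c * ρ)) ^ s ∧
        F ∩ Metric.closedBall (y i) (u i) ⊆ ⋃ y ∈ S, Metric.closedBall y ρ := by
      intro i hi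
      obtain ⟨a, b, e⟩ := hu i hi
      refine ih (y i) a (u i) (le_trans (by gcongr) b) (e.trans (le_trans ?_ h2)) ?_
      · nlinarith
      · calc u i * θ ^ k ≤ θ * r * θ ^ k := by gcongr
          _ = r * θ ^ (k+1) := by ring
          _ ≤ ρ := h3
    choose! S hS1 hS2 using hloc
    refine ⟨t.biUnion S, ?_, ?_⟩
    · calc ((t.biUnion S).card : ℝ) ≤ ∑ i ∈ t, ((S i).card : ℝ) := by
            exact_mod_cast Finset.card_biUnion_le
        _ ≤ ∑ i ∈ t, (u i / (c * ρ)) ^ s := Finset.sum_le_sum hS1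
        _ = (∑ i ∈ t, u i ^ s) / (c * ρ) ^ s := by
            rw [Finset.sum_div]
            refine Finset.sum_congr rfl fun i hi => ?_
            rw [Real.div_rpow (le_trans (by positivity) (hu i hi).2.1) hcρ.le]
        _ ≤ r ^ s / (c * ρ) ^ s := by gcongr
        _ = _ := by rw [Real.div_rpow hr0.le hcρ.le]
    · intro z hz
      obtain ⟨i, hi, hzi⟩ := Set.mem_iUnion₂.1 (hcov hz)
      obtain ⟨w, hw, hzw⟩ := Set.mem_iUnion₂.1 (hS2 i hi ⟨hz.1, hzi⟩)
      exact Set.mem_iUnion₂.2 ⟨w, Finset.mem_biUnion.2 ⟨i, hi, hw⟩, hzw⟩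

lemma mem_assouadSet {α : Type} [PseudoMetricSpace α] (F : Set α) (hF : IsCompact F)
    (s c θ δ : ℝ) (hs : 0 ≤ s) (hc : 0 < c) (hc1 : c ≤ 1) (hθ0 : 0 < θ) (hθ1 : θ < 1)
    (hδ : 0 < δ) (H : ∀ x ∈ F, ∀ r, 0 < r → r ≤ δ → GoodCover F s c θ x r) :
    s ∈ AssouadSet F := by
  classical
  -- uniform cover
  have key : ∀ x ∈ F, ∀ r R, 0 < r → r ≤ R → R ≤ δ → ∃ S : Finset α,
      (S.card : ℝ) ≤ (2 / c) ^ s * (R / r) ^ s ∧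
      F ∩ Metric.closedBall x R ⊆ ⋃ y ∈ S, Metric.ball y r := by
    intro x hx r R hr hrR hR
    have hR0 : 0 < R := hr.trans_le hrR
    obtain ⟨k, hk⟩ := exists_pow_lt_of_lt_one (div_pos (half_pos hr) hR0) hθ1
    obtain ⟨S, hS1, hS2⟩ := iter_cover F s c θ δ (r/2) hs hc hθ0 (half_pos hr) hθ1 H k x hx R
      (by nlinarith) hR (by rw [lt_div_iff₀ hR0] at hk; linarith)
    refine ⟨S, hS1.trans (le_of_eq ?_), hS2.trans ?_⟩
    · rw [← Real.mul_rpow (by positivity) (by positivity)]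
      congr 1; field_simp
    · exact Set.iUnion₂_mono fun y _ => Metric.closedBall_subset_ball (by linarith)
  obtain ⟨T, hTF, hTfin, hTcov⟩ := hF.finite_cover_balls hδ
  lift T to Finset α using hTfin
  refine ⟨hs, (T.card + 1) * (2 / c) ^ s, by positivity, ?_⟩
  intro x hx r R hr hrR hR1
  have hR0 : 0 < R := hr.trans_le hrR
  by_cases hRδ : R ≤ δ
  · obtain ⟨S, hS1, hS2⟩ := key x hx r R hr hrR hRδ
    have h1 : (coverNum r (F ∩ Metric.ball x R) : ℝ) ≤ S.card := by
      exact_mod_cast coverNum_le S (Set.Subset.trans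
        (Set.inter_subset_inter_right _ Metric.ball_subset_closedBall) hS2)
    have : 0 ≤ (T.card : ℝ) * ((2 / c) ^ s * (R / r) ^ s) := by positivity
    nlinarith
  · push Not at hRδ
    have hr' : 0 < min r δ := lt_min hr hδ
    have hloc : ∀ y ∈ T, ∃ S : Finset α,
      (S.card : ℝ) ≤ (2 / c) ^ s * (R / r) ^ s ∧
      F ∩ Metric.closedBall y δ ⊆ ⋃ z ∈ S, Metric.ball z r := by
      intro y hy
      obtain ⟨S, hS1, hS2⟩ := key y (hTF hy) (min r δ) δ hr' (min_le_right _ _) le_rfl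
      refine ⟨S, hS1.trans ?_, hS2.trans ?_⟩
      · have : δ / min r δ ≤ R / r := by
          rw [div_le_div_iff₀ hr' hr]
          rcases min_cases r δ with ⟨h, _⟩ | ⟨h, _⟩ <;> rw [h] <;> nlinarith
        gcongr
      · exact Set.iUnion₂_mono fun y _ => Metric.ball_subset_ball (min_le_left _ _)
    choose! S hS1 hS2 using hloc
    have h1 : (coverNum r (F ∩ Metric.ball x R) : ℝ) ≤ (T.biUnion S).card := by
      norm_cast
      refine coverNum_le _ ?_
      intro z hz
      obtain ⟨i, hi, hzi⟩ := Set.mem_iUnion₂.1 (hTcov hz.1)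
      obtain ⟨w, hw, hzw⟩ := Set.mem_iUnion₂.1 (hS2 i hi ⟨hz.1, Metric.ball_subset_closedBall hzi⟩)
      exact Set.mem_iUnion₂.2 ⟨w, Finset.mem_biUnion.2 ⟨i, hi, hw⟩, hzw⟩
    have h2 : ((T.biUnion S).card : ℝ) ≤ T.card * ((2 / c) ^ s * (R / r) ^ s) := by
      calc ((T.biUnion S).card : ℝ) ≤ ∑ i ∈ T, ((S i).card : ℝ) := by
            exact_mod_cast Finset.card_biUnion_le
        _ ≤ ∑ i ∈ T, ((2 / c) ^ s * (R / r) ^ s) := Finset.sum_le_sum hS1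
        _ = _ := by simp
    have : 0 ≤ ((2 / c) ^ s * (R / r) ^ s) := by positivity
    nlinarith

/-- The rescaled piece of `F`. -/
def blow {d : ℕ} (F : Set (EuclideanSpace ℝ (Fin d))) (x : EuclideanSpace ℝ (Fin d)) (r : ℝ) :
    Set (EuclideanSpace ℝ (Fin d)) :=
  (fun y => r⁻¹ • (y - x)) '' F ∩ Metric.closedBall 0 1

lemma mem_blow {d : ℕ} {F : Set (EuclideanSpace ℝ (Fin d))} {x y : EuclideanSpace ℝ (Fin d)}
    {r : ℝ} (hr : 0 < r) (hy : y ∈ F) (hxy : dist y x ≤ r) : r⁻¹ • (y - x) ∈ blow F x r := by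
  refine ⟨⟨y, hy, rfl⟩, ?_⟩
  rw [mem_closedBall_zero_iff, norm_smul, norm_inv, Real.norm_of_nonneg hr.le, ← dist_eq_norm,
    inv_mul_le_iff₀ hr]
  simpa using hxy

lemma goodCover_of_sets {d : ℕ} {F : Set (EuclideanSpace ℝ (Fin d))}
    {x : EuclideanSpace ℝ (Fin d)} {r s c θ : ℝ} (hr : 0 < r) (hc : 0 < c)
    {ι : Type} (t : Finset ι) (U : ι → Set (EuclideanSpace ℝ (Fin d))) (u : ι → ℝ)
    (hU : ∀ i ∈ t, ∀ a ∈ U i, ∀ b ∈ U i, dist a b ≤ u i)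
    (hu : ∀ i ∈ t, c ≤ u i ∧ u i ≤ θ) (hsum : ∑ i ∈ t, u i ^ s ≤ 1)
    (hcov : blow F x r ⊆ ⋃ i ∈ t, U i) : GoodCover F s c θ x r := by
  classical
  let V : ι → Set (EuclideanSpace ℝ (Fin d)) := fun i => {y | y ∈ F ∧ r⁻¹ • (y - x) ∈ U i}
  have hch : ∀ i, ∃ y, (V i).Nonempty → y ∈ V i := by
    intro i
    by_cases h : (V i).Nonempty
    · exact ⟨h.some, fun _ => h.some_mem⟩
    · exact ⟨0, fun h' => absurd h' h⟩
  choose y hy using hch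
  refine ⟨ι, t.filter (fun i => (V i).Nonempty), y, fun i => r * u i, ?_, ?_, ?_⟩
  · intro i hi
    rw [Finset.mem_filter] at hi
    obtain ⟨h1, h2⟩ := hu i hi.1
    refine ⟨(hy i hi.2).1, ?_, ?_⟩ <;> nlinarith
  · intro z hz
    obtain ⟨i, hi, hzi⟩ := Set.mem_iUnion₂.1 (hcov (mem_blow hr hz.1 hz.2))
    have hzV : z ∈ V i := ⟨hz.1, hzi⟩
    refine Set.mem_iUnion₂.2 ⟨i, Finset.mem_filter.2 ⟨hi, ⟨z, hzV⟩⟩, ?_⟩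
    have := hU i hi _ hzi _ (hy i ⟨z, hzV⟩).2
    rw [dist_smul₀, norm_inv, Real.norm_of_nonneg hr.le, dist_sub_right,
      inv_mul_le_iff₀ hr] at this
    exact this
  · have hu0 : ∀ i ∈ t, 0 ≤ u i := fun i hi => hc.le.trans (hu i hi).1
    calc ∑ i ∈ t.filter (fun i => (V i).Nonempty), (r * u i) ^ s
        ≤ ∑ i ∈ t, (r * u i) ^ s := Finset.sum_le_sum_of_subset_of_nonneg
          (Finset.filter_subset _ _) (fun i hi _ => Real.rpow_nonneg
            (mul_nonneg hr.le (hu0 i hi)) _)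
      _ = r ^ s * ∑ i ∈ t, u i ^ s := by
          rw [Finset.mul_sum]
          exact Finset.sum_congr rfl fun i hi => Real.mul_rpow hr.le (hu0 i hi)
      _ ≤ r ^ s * 1 := by gcongr
      _ = _ := mul_one _

lemma assouadSet_nonempty {d : ℕ} (F : Set (EuclideanSpace ℝ (Fin d))) (hF : IsCompact F) :
    (AssouadSet F).Nonempty := by
  classical
  obtain ⟨T, -, hTfin, hTcov⟩ := (isCompact_closedBall (0 : EuclideanSpace ℝ (Fin d)) 1
    ).finite_cover_balls (e := 1/4) (by norm_num)
  lift T to Finset (EuclideanSpace ℝ (Fin d)) using hTfin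
  obtain ⟨k, hk⟩ := pow_unbounded_of_one_lt (T.card : ℝ) (by norm_num : (1:ℝ) < 2)
  refine ⟨(k : ℝ), mem_assouadSet F hF k (1/2) (1/2) 1 (by positivity) (by norm_num) (by norm_num)
    (by norm_num) (by norm_num) (by norm_num) ?_⟩
  intro x hx r hr _
  refine goodCover_of_sets hr (by norm_num) T (fun y => Metric.ball y (1/4)) (fun _ => 1/2)
    ?_ (fun _ _ => ⟨le_rfl, le_rfl⟩) ?_ (Set.inter_subset_right.trans hTcov)
  · intro i _ a ha b hb
    have := dist_triangle_right a b i
    rw [Metric.mem_ball] at ha hb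
    linarith
  · rw [Finset.sum_const, nsmul_eq_mul, Real.rpow_natCast, div_pow, one_pow, mul_one_div,
      div_le_one (by positivity)]
    exact hk.le

lemma blow_compact {d : ℕ} {F : Set (EuclideanSpace ℝ (Fin d))} (hF : IsCompact F)
    (x : EuclideanSpace ℝ (Fin d)) (r : ℝ) : IsCompact (blow F x r) :=
  (hF.image (by fun_prop)).inter_right Metric.isClosed_closedBall

lemma blow_nonempty {d : ℕ} {F : Set (EuclideanSpace ℝ (Fin d))}
    {x : EuclideanSpace ℝ (Fin d)} (hx : x ∈ F) {r : ℝ} (hr : 0 < r) : (blow F x r).Nonempty :=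
  ⟨_, mem_blow hr hx (by simpa using hr.le)⟩

lemma exists_tangent {d : ℕ} {F : Set (EuclideanSpace ℝ (Fin d))} (hF : IsCompact F)
    (x : ℕ → EuclideanSpace ℝ (Fin d)) (r : ℕ → ℝ) (hx : ∀ n, x n ∈ F) (hr : ∀ n, 0 < r n) :
    ∃ (E : Set (EuclideanSpace ℝ (Fin d))) (φ : ℕ → ℕ), StrictMono φ ∧ IsCompact E ∧ E.Nonempty ∧
      Tendsto (fun n => Metric.hausdorffDist (blow F (x (φ n)) (r (φ n))) E) atTop (nhds 0) := by
  let K := Metric.closedBall (0 : EuclideanSpace ℝ (Fin d)) 1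
  haveI : CompactSpace K := isCompact_iff_compactSpace.1 (isCompact_closedBall _ _)
  have himg : ∀ n, (Subtype.val : K → _) '' (Subtype.val ⁻¹' blow F (x n) (r n))
      = blow F (x n) (r n) := by
    intro n
    rw [Subtype.image_preimage_coe]
    exact Set.inter_eq_right.2 Set.inter_subset_right
  let A : ℕ → TopologicalSpace.NonemptyCompacts K := fun n =>
    ⟨⟨Subtype.val ⁻¹' blow F (x n) (r n),
      ((blow_compact hF _ _).isClosed.preimage continuous_subtype_val).isCompact⟩, by
      have := blow_nonempty (hx n) (hr n)
      rw [← himg n] at this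
      exact Set.image_nonempty.1 this⟩
  obtain ⟨B, φ, hφ, hlim⟩ := CompactSpace.tendsto_subseq A
  refine ⟨Subtype.val '' (B : Set K), φ, hφ, B.isCompact.image continuous_subtype_val,
    B.nonempty.image _, ?_⟩
  rw [tendsto_iff_dist_tendsto_zero] at hlim
  refine hlim.congr fun n => ?_
  rw [← himg, Metric.hausdorffDist_image isometry_subtype_coe]
  exact Metric.NonemptyCompacts.dist_eq

lemma content_cover {d : ℕ} {E : Set (EuclideanSpace ℝ (Fin d))} (hE : IsCompact E) {η : ℝ}
    (hη : 0 < η) (h : hausdorffContent η E < 1) :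
    ∃ (t : Finset ℕ) (U : ℕ → Set (EuclideanSpace ℝ (Fin d))) (u : ℕ → ℝ),
      (∀ i, IsOpen (U i)) ∧ (∀ i, ∀ a ∈ U i, ∀ b ∈ U i, dist a b ≤ u i) ∧
      (∀ i ∈ t, 0 < u i ∧ u i < 1) ∧ ∑ i ∈ t, u i ^ η < 1 ∧ E ⊆ ⋃ i ∈ t, U i := by
  unfold hausdorffContent at h
  simp only [iInf_lt_iff] at h
  obtain ⟨U, hU, hsum⟩ := h
  change ∑' n, Metric.ediam (U n) ^ η < 1 at hsum
  obtain ⟨ε, hε0, hε⟩ : ∃ ε : NNReal, 0 < ε ∧ ∑' n, Metric.ediam (U n) ^ η + ε < 1 := by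
    obtain ⟨b, hb1, hb2⟩ := ENNReal.lt_iff_exists_add_pos_lt.1 hsum
    exact ⟨b, hb1, hb2⟩
  obtain ⟨e, he0, he⟩ := ENNReal.exists_pos_sum_of_countable (ENNReal.coe_ne_zero.2 hε0.ne') ℕ
  have hlt1 : ∀ n, Metric.ediam (U n) ^ η < 1 := fun n =>
    (ENNReal.le_tsum n).trans_lt hsum
  have hfin : ∀ n, Metric.ediam (U n) ≠ ⊤ := by
    intro n hn
    have := hlt1 n
    rw [hn, ENNReal.top_rpow_of_pos hη] at this
    exact absurd this (by simp)
  have hδ : ∀ n, ∃ δ : NNReal, 0 < δ ∧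
      (Metric.ediam (U n) + 2 * δ) ^ η < Metric.ediam (U n) ^ η + e n := by
    intro n
    have hcont : Continuous (fun δ : NNReal => (Metric.ediam (U n) + 2 * (δ : ENNReal)) ^ η) := by
      have h1 : Continuous fun y : ENNReal => y ^ η := ENNReal.continuous_rpow_const
      have h2 : Continuous fun δ : NNReal => Metric.ediam (U n) + 2 * (δ : ENNReal) :=
        continuous_const.add (ENNReal.continuous_const_mul (by simp) |>.comp
          ENNReal.continuous_coe)
      exact h1.comp h2
    have hev := hcont.tendsto 0
    simp only [ENNReal.coe_zero, mul_zero, add_zero] at hev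
    have h3 : Metric.ediam (U n) ^ η < Metric.ediam (U n) ^ η + e n :=
      ENNReal.lt_add_right ((hlt1 n).trans (by simp)).ne (ENNReal.coe_ne_zero.2 (he0 n).ne')
    have h4 := (hev.eventually_lt_const h3)
    have h5 : ∀ᶠ δ : NNReal in nhdsWithin 0 (Set.Ioi 0), 
      (Metric.ediam (U n) + 2 * δ) ^ η < Metric.ediam (U n) ^ η + e n :=
      h4.filter_mono nhdsWithin_le_nhds
    obtain ⟨δ, h6, h7⟩ := (h5.and self_mem_nhdsWithin).exists
    exact ⟨δ, h7, h6⟩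
  choose δ hδ0 hδ using hδ
  have hvfin : ∀ n, Metric.ediam (U n) + 2 * δ n ≠ ⊤ := fun n =>
    ENNReal.add_ne_top.2 ⟨hfin n, ENNReal.mul_ne_top (by simp) (by simp)⟩
  let u : ℕ → ℝ := fun n => (Metric.ediam (U n) + 2 * δ n).toReal
  have hu0 : ∀ n, 0 < u n := fun n => ENNReal.toReal_pos (by
    have := hδ0 n
    simp [this.ne']) (hvfin n)
  have hcov : E ⊆ ⋃ n, Metric.thickening (δ n) (U n) := hU.trans
    (Set.iUnion_mono fun n => Metric.self_subset_thickening (hδ0 n) _)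
  obtain ⟨t, ht⟩ := hE.elim_finite_subcover _ (fun n => Metric.isOpen_thickening) hcov
  have hsum' : ∑ i ∈ t, u i ^ η < 1 := by
    have h1 : ∑ i ∈ t, (Metric.ediam (U i) + 2 * δ i) ^ η < 1 := by
      calc ∑ i ∈ t, (Metric.ediam (U i) + 2 * δ i) ^ η
          ≤ ∑' i, (Metric.ediam (U i) + 2 * δ i) ^ η := ENNReal.sum_le_tsum _
        _ ≤ ∑' i, (Metric.ediam (U i) ^ η + e i) := ENNReal.tsum_le_tsum fun i => (hδ i).le
        _ = ∑' i, Metric.ediam (U i) ^ η + ∑' i, (e i : ENNReal) := ENNReal.tsum_add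
        _ ≤ ∑' i, Metric.ediam (U i) ^ η + ε := by gcongr
        _ < 1 := hε
    have h2 := (ENNReal.toReal_lt_toReal (h1.trans (by simp)).ne (by simp)).2 h1
    rw [ENNReal.toReal_sum (fun i _ => ENNReal.rpow_ne_top_of_nonneg hη.le (hvfin i))] at h2
    simpa [u, ENNReal.toReal_rpow] using h2
  refine ⟨t, fun n => Metric.thickening (δ n) (U n), u, fun n => Metric.isOpen_thickening, ?_, ?_,
    hsum', ht⟩
  · intro i a ha b hb
    rw [dist_edist]
    exact ENNReal.toReal_mono (hvfin i) ((Metric.edist_le_ediam_of_mem ha hb).trans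
      (Metric.ediam_thickening_le _))
  · intro i hi
    refine ⟨hu0 i, ?_⟩
    have h1 : u i ^ η < 1 := (Finset.single_le_sum (f := fun i => u i ^ η)
      (fun j _ => Real.rpow_nonneg (hu0 j).le _) hi).trans_lt hsum'
    by_contra hcon
    push Not at hcon
    exact absurd (Real.one_le_rpow hcon hη.le) (not_le.2 h1)

lemma content_part {d : ℕ} {F : Set (EuclideanSpace ℝ (Fin d))} (hF : IsCompact F)
    {η : ℝ} (hη : 0 < η) (hη' : η = assouadDim F)
    (hcon : ∀ E, IsWeakTangent F E → hausdorffContent η E < 1) : False := by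
  have hbad : ∀ n : ℕ, ∃ x ∈ F, ∃ r : ℝ, 0 < r ∧ r ≤ 1 / ((n : ℝ) + 1) ∧
      ¬ GoodCover F (η - η / ((n : ℝ) + 2)) (1 / ((n : ℝ) + 2)) (1 - 1 / ((n : ℝ) + 2)) x r := by
    intro n
    by_contra hno
    push Not at hno
    have hn2 : (0 : ℝ) < 1 / ((n : ℝ) + 2) := by positivity
    have hn3 : 1 / ((n : ℝ) + 2) < 1 := by
      rw [div_lt_one (by positivity)]; linarith [(Nat.cast_nonneg n : (0:ℝ) ≤ n)]
    have hn4 : η / ((n : ℝ) + 2) = η * (1 / ((n : ℝ) + 2)) := by ring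
    have hmem := mem_assouadSet F hF (η - η / ((n : ℝ) + 2)) (1 / ((n : ℝ) + 2))
      (1 - 1 / ((n : ℝ) + 2)) (1 / ((n : ℝ) + 1)) (by rw [hn4]; nlinarith) hn2 hn3.le
      (by linarith) (by linarith) (by positivity) hno
    have hle : assouadDim F ≤ η - η / ((n : ℝ) + 2) := csInf_le ⟨0, fun s hs => hs.1⟩ hmem
    have : 0 < η / ((n : ℝ) + 2) := by positivity
    linarith
  choose x hx r hr0 hr1 hnot using hbad
  obtain ⟨E, φ, hφ, hEc, hEne, hlim⟩ := exists_tangent hF x r hx hr0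
  have hn0 : ∀ n : ℕ, 1 / ((n : ℝ) + 1) ≤ 1 := fun n => by
    rw [div_le_one (by positivity)]; linarith [(Nat.cast_nonneg n : (0:ℝ) ≤ n)]
  have hrt : Tendsto r atTop (nhds 0) :=
    squeeze_zero (fun n => (hr0 n).le) hr1 tendsto_one_div_add_atTop_nhds_zero_nat
  have hE : IsWeakTangent F E := ⟨hEc, hEne, x ∘ φ, r ∘ φ, fun n => hx _, fun n => hr0 _,
    fun n => (hr1 _).trans (hn0 _), hrt.comp hφ.tendsto_atTop, hlim⟩
  obtain ⟨t, U, u, hUo, hUd, hu, hsum, hcov⟩ := content_cover hEc hη (hcon E hE)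
  have hopen : IsOpen (⋃ i ∈ t, U i) := isOpen_biUnion fun i _ => hUo i
  obtain ⟨δ, hδ0, hδ⟩ := hEc.exists_thickening_subset_open hopen hcov
  have hz : Tendsto (fun n : ℕ => 1 / ((n : ℝ) + 2)) atTop (nhds 0) := by
    have := (tendsto_add_atTop_iff_nat 1).2 (tendsto_one_div_add_atTop_nhds_zero_nat (𝕜 := ℝ))
    refine this.congr fun n => ?_
    push_cast
    ring
  have hz' := hz.comp hφ.tendsto_atTop
  have e1 : ∀ᶠ n in atTop, Metric.hausdorffDist (blow F (x (φ n)) (r (φ n))) E < δ :=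
    hlim.eventually_lt_const hδ0
  have e2 : ∀ᶠ n in atTop, ∀ i ∈ t, 1 / ((φ n : ℝ) + 2) < u i :=
    (Filter.eventually_all_finset t).2 fun i hi => hz'.eventually_lt_const (hu i hi).1
  have e3 : ∀ᶠ n in atTop, ∀ i ∈ t, 1 / ((φ n : ℝ) + 2) < 1 - u i :=
    (Filter.eventually_all_finset t).2 fun i hi =>
      hz'.eventually_lt_const (by linarith [(hu i hi).2])
  have e4 : ∀ᶠ n in atTop, ∑ i ∈ t, u i ^ (η - η / ((φ n : ℝ) + 2)) < 1 := by
    have hc : Tendsto (fun n => ∑ i ∈ t, u i ^ (η - η * (1 / ((φ n : ℝ) + 2)))) atTop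
        (nhds (∑ i ∈ t, u i ^ (η - η * 0))) := by
      refine tendsto_finsetSum _ fun i hi => ?_
      exact ((Real.continuous_const_rpow (hu i hi).1.ne').tendsto _).comp
        (tendsto_const_nhds.sub (tendsto_const_nhds.mul hz'))
    rw [mul_zero, sub_zero] at hc
    filter_upwards [hc.eventually_lt_const hsum] with n hn
    simpa only [mul_one_div] using hn
  obtain ⟨n, h1, h2, h3, h4⟩ := (e1.and (e2.and (e3.and e4))).exists
  refine hnot (φ n) (goodCover_of_sets (hr0 _) (by positivity) t U u (fun i _ => hUd i) ?_ h4.le ?_)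
  · intro i hi
    exact ⟨(h2 i hi).le, by linarith [h3 i hi]⟩
  · refine Set.Subset.trans (fun z hz => ?_) hδ
    obtain ⟨y, hy, hzy⟩ := Metric.exists_dist_lt_of_hausdorffDist_lt hz h1
      (Metric.hausdorffEDist_ne_top_of_nonempty_of_bounded (blow_nonempty (hx _) (hr0 _)) hEne
        (blow_compact hF _ _).isBounded hEc.isBounded)
    exact Metric.mem_thickening_iff.2 ⟨y, hy, hzy⟩

lemma exists_weakTangent {d : ℕ} {F : Set (EuclideanSpace ℝ (Fin d))} (hF : IsCompact F)
    (hne : F.Nonempty) : ∃ E, IsWeakTangent F E := by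
  obtain ⟨x, hx⟩ := hne
  obtain ⟨E, φ, hφ, hEc, hEne, hlim⟩ := exists_tangent hF (fun _ => x)
    (fun n : ℕ => 1 / ((n : ℝ) + 1)) (fun _ => hx) (fun n => by positivity)
  exact ⟨E, hEc, hEne, fun _ => x, fun n => 1 / ((φ n : ℝ) + 1), fun _ => hx,
    fun n => by positivity, fun n => by
      rw [div_le_one (by positivity)]; linarith [(Nat.cast_nonneg (φ n) : (0:ℝ) ≤ φ n)],
    tendsto_one_div_add_atTop_nhds_zero_nat.comp hφ.tendsto_atTop, hlim⟩

lemma exists_cover {α : Type*} [PseudoMetricSpace α] {F : Set α} (hF : IsCompact F) (E : Set α)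
    (hE : E ⊆ F) {r : ℝ} (hr : 0 < r) :
    ∃ S : Finset α, S.card = coverNum r E ∧ E ⊆ ⋃ x ∈ S, Metric.ball x r := by
  obtain ⟨T, -, hTfin, hTcov⟩ := hF.finite_cover_balls hr
  lift T to Finset α using hTfin
  exact Nat.sInf_mem (s := {n : ℕ | ∃ S : Finset α, S.card = n ∧ E ⊆ ⋃ x ∈ S, Metric.ball x r})
    ⟨T.card, T, rfl, hE.trans hTcov⟩

lemma blow_cover {d : ℕ} {F : Set (EuclideanSpace ℝ (Fin d))} (hF : IsCompact F) {s : ℝ}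
    (hs : s ∈ AssouadSet F) : ∃ K : ℝ, 0 ≤ K ∧ ∀ x ∈ F, ∀ r ρ : ℝ, 0 < r → r ≤ 1 → 0 < ρ → ρ ≤ 1 →
      ∃ S : Finset (EuclideanSpace ℝ (Fin d)), (S.card : ℝ) ≤ K * (1 / ρ) ^ s ∧
        blow F x r ⊆ ⋃ y ∈ S, Metric.ball y ρ := by
  classical
  obtain ⟨hs0, C, hC, H⟩ := hs
  obtain ⟨T, hTF, hTfin, hTcov⟩ := hF.finite_cover_balls one_pos
  lift T to Finset (EuclideanSpace ℝ (Fin d)) using hTfin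
  refine ⟨(T.card + 1) * (C * 2 ^ s), by positivity, ?_⟩
  intro x hx r ρ hr hr1 hρ hρ1
  have hpos : 0 < ρ * r := by positivity
  have hq : 0 ≤ C * (2 / ρ) ^ s := by positivity
  have main : ∃ S : Finset (EuclideanSpace ℝ (Fin d)),
      (S.card : ℝ) ≤ (T.card + 1) * (C * (2 / ρ) ^ s) ∧
        F ∩ Metric.closedBall x r ⊆ ⋃ y ∈ S, Metric.ball y (ρ * r) := by
    by_cases hr2 : 2 * r ≤ 1
    · obtain ⟨S, hS1, hS2⟩ := exists_cover hF (F ∩ Metric.ball x (2 * r)) Set.inter_subset_left hpos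
      refine ⟨S, ?_, Set.Subset.trans (Set.inter_subset_inter_right _
        (Metric.closedBall_subset_ball (by linarith))) hS2⟩
      have := H x hx (ρ * r) (2 * r) hpos (by nlinarith) hr2
      rw [← hS1, mul_div_mul_right _ _ hr.ne'] at this
      have : 0 ≤ (T.card : ℝ) * (C * (2 / ρ) ^ s) := by positivity
      nlinarith
    · push Not at hr2
      have hloc : ∀ y ∈ T, ∃ S : Finset (EuclideanSpace ℝ (Fin d)),
          (S.card : ℝ) ≤ C * (2 / ρ) ^ s ∧
          F ∩ Metric.ball y 1 ⊆ ⋃ z ∈ S, Metric.ball z (ρ * r) := by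
        intro y hy
        obtain ⟨S, hS1, hS2⟩ := exists_cover hF (F ∩ Metric.ball y 1) Set.inter_subset_left hpos
        refine ⟨S, ?_, hS2⟩
        rw [hS1]
        refine (H y (hTF hy) (ρ * r) 1 hpos (by nlinarith) le_rfl).trans ?_
        have : 1 / (ρ * r) ≤ 2 / ρ := by
          rw [div_le_div_iff₀ hpos hρ]; nlinarith
        gcongr
      choose! S hS1 hS2 using hloc
      refine ⟨T.biUnion S, ?_, ?_⟩
      · calc ((T.biUnion S).card : ℝ) ≤ ∑ i ∈ T, ((S i).card : ℝ) := by
              exact_mod_cast Finset.card_biUnion_le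
          _ ≤ ∑ i ∈ T, (C * (2 / ρ) ^ s) := Finset.sum_le_sum hS1
          _ = T.card * (C * (2 / ρ) ^ s) := by simp
          _ ≤ _ := by gcongr; linarith
      · intro z hz
        obtain ⟨i, hi, hzi⟩ := Set.mem_iUnion₂.1 (hTcov hz.1)
        obtain ⟨w, hw, hzw⟩ := Set.mem_iUnion₂.1 (hS2 i hi ⟨hz.1, hzi⟩)
        exact Set.mem_iUnion₂.2 ⟨w, Finset.mem_biUnion.2 ⟨i, hi, hw⟩, hzw⟩
  obtain ⟨S, hS1, hS2⟩ := main
  refine ⟨S.image (fun y => r⁻¹ • (y - x)), ?_, ?_⟩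
  · calc (((S.image (fun y => r⁻¹ • (y - x))).card : ℕ) : ℝ) ≤ S.card := by
          exact_mod_cast Finset.card_image_le
      _ ≤ (T.card + 1) * (C * (2 / ρ) ^ s) := hS1
      _ = _ := by
        rw [mul_assoc, mul_assoc, ← Real.mul_rpow (by norm_num) (by positivity), mul_one_div]
  · rintro _ ⟨⟨y, hy, rfl⟩, hy1⟩
    have hyx : y ∈ Metric.closedBall x r := by
      rw [mem_closedBall_zero_iff, norm_smul, norm_inv, Real.norm_of_nonneg hr.le,
        ← dist_eq_norm, inv_mul_le_iff₀ hr, mul_one] at hy1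
      exact hy1
    obtain ⟨w, hw, hyw⟩ := Set.mem_iUnion₂.1 (hS2 ⟨hy, hyx⟩)
    refine Set.mem_iUnion₂.2 ⟨_, Finset.mem_image_of_mem _ hw, ?_⟩
    rw [Metric.mem_ball, dist_smul₀, norm_inv, Real.norm_of_nonneg hr.le, dist_sub_right,
      inv_mul_lt_iff₀ hr, mul_comm]
    exact hyw

lemma dimH_micro {d : ℕ} {F A : Set (EuclideanSpace ℝ (Fin d))} (hF : IsCompact F) {s : ℝ}
    (hs : s ∈ AssouadSet F) (hA : IsMicroset F A) : dimH A ≤ ENNReal.ofReal s := by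
  obtain ⟨K, hK, H⟩ := blow_cover hF hs
  have hs0 : 0 ≤ s := hs.1
  obtain ⟨hAc, hAne, x, r, hx, hr0, hr1, hlim⟩ := hA
  have hcov : ∀ n : ℕ, ∃ S : Finset (EuclideanSpace ℝ (Fin d)),
      (S.card : ℝ) ≤ K * (1 / (1 / ((n : ℝ) + 1))) ^ s ∧
      A ⊆ ⋃ y ∈ S, Metric.ball y (2 * (1 / ((n : ℝ) + 1))) := by
    intro n
    have hρ : (0 : ℝ) < 1 / ((n : ℝ) + 1) := by positivity
    have hρ1 : 1 / ((n : ℝ) + 1) ≤ 1 := by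
      rw [div_le_one (by positivity)]; linarith [(Nat.cast_nonneg n : (0:ℝ) ≤ n)]
    obtain ⟨m, hm⟩ := (hlim.eventually_lt_const hρ).exists
    obtain ⟨S, hS1, hS2⟩ := H (x m) (hx m) (r m) _ (hr0 m) (hr1 m) hρ hρ1
    refine ⟨S, hS1, fun a ha => ?_⟩
    obtain ⟨b, hb, hab⟩ := Metric.exists_dist_lt_of_hausdorffDist_lt' ha hm
      (Metric.hausdorffEDist_ne_top_of_nonempty_of_bounded (blow_nonempty (hx _) (hr0 _)) hAne
        (blow_compact hF _ _).isBounded hAc.isBounded)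
    obtain ⟨w, hw, hbw⟩ := Set.mem_iUnion₂.1 (hS2 hb)
    refine Set.mem_iUnion₂.2 ⟨w, hw, ?_⟩
    rw [Metric.mem_ball] at hbw ⊢
    have := dist_triangle_left a w b
    linarith
  choose S hS1 hS2 using hcov
  have hdiam : ∀ (n : ℕ) (i : S n),
      Metric.ediam (Metric.ball (i : EuclideanSpace ℝ (Fin d)) (2 * (1 / ((n : ℝ) + 1))))
        ≤ ENNReal.ofReal (4 * (1 / ((n : ℝ) + 1))) := by
    intro n i
    refine Metric.ediam_le_of_forall_dist_le fun a ha b hb => ?_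
    have := dist_triangle_right a b i
    rw [Metric.mem_ball] at ha hb
    linarith
  borelize (EuclideanSpace ℝ (Fin d))
  have hmeas : MeasureTheory.Measure.hausdorffMeasure s A ≤ ENNReal.ofReal (K * 4 ^ s) := by
    refine (MeasureTheory.Measure.hausdorffMeasure_le_liminf_sum (l := atTop) s A
      (fun n : ℕ => ENNReal.ofReal (4 * (1 / ((n : ℝ) + 1)))) ?_
      (fun n (i : S n) => Metric.ball (i : EuclideanSpace ℝ (Fin d)) (2 * (1 / ((n : ℝ) + 1))))
      (Eventually.of_forall hdiam) (Eventually.of_forall fun n => ?_)).trans ?_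
    · have := ENNReal.tendsto_ofReal
        ((tendsto_one_div_add_atTop_nhds_zero_nat (𝕜 := ℝ)).const_mul 4)
      simpa using this
    · intro a ha
      obtain ⟨w, hw, haw⟩ := Set.mem_iUnion₂.1 (hS2 n ha)
      exact Set.mem_iUnion.2 ⟨⟨w, hw⟩, haw⟩
    · refine (liminf_le_liminf (v := fun _ => ENNReal.ofReal (K * 4 ^ s))
        (Eventually.of_forall fun n => ?_)).trans (by simp)
      calc ∑ i : S n, Metric.ediam (Metric.ball (i : EuclideanSpace ℝ (Fin d))
              (2 * (1 / ((n : ℝ) + 1)))) ^ s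
          ≤ ∑ i : S n, ENNReal.ofReal (4 * (1 / ((n : ℝ) + 1))) ^ s :=
            Finset.sum_le_sum fun i _ => ENNReal.rpow_le_rpow (hdiam n i) hs0
        _ = ENNReal.ofReal ((S n).card * (4 * (1 / ((n : ℝ) + 1))) ^ s) := by
            rw [ENNReal.ofReal_rpow_of_nonneg (by positivity) hs0,
              ENNReal.ofReal_mul (by positivity)]
            simp
        _ ≤ ENNReal.ofReal (K * 4 ^ s) := by
            refine ENNReal.ofReal_le_ofReal ?_
            calc (S n).card * (4 * (1 / ((n : ℝ) + 1))) ^ s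
                ≤ K * (1 / (1 / ((n : ℝ) + 1))) ^ s * (4 * (1 / ((n : ℝ) + 1))) ^ s := by
                  gcongr; exact hS1 n
              _ = K * 4 ^ s := by
                  rw [mul_assoc, ← Real.mul_rpow (by positivity) (by positivity)]
                  congr 2
                  field_simp
  have : dimH A ≤ (s.toNNReal : ENNReal) := by
    refine dimH_le_of_hausdorffMeasure_ne_top ?_
    rw [Real.coe_toNNReal s hs0]
    exact (hmeas.trans_lt ENNReal.ofReal_lt_top).ne
  exact this

end MicroAux

theorem stmt12 (d : ℕ) (F : Set (EuclideanSpace ℝ (Fin d)))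
    (hF : IsCompact F) (hFne : F.Nonempty) (η : ℝ) (hη : η = assouadDim F) :
    (∀ A, IsMicroset F A → dimH A ≤ ENNReal.ofReal η) ∧
      ∃ E, IsWeakTangent F E ∧ 1 ≤ hausdorffContent η E := by
  refine ⟨fun A hA => ?_, ?_⟩
  · have hset : assouadDim F = sInf (MicroAux.AssouadSet F) := rfl
    refine ENNReal.le_of_forall_pos_le_add fun ε hε _ => ?_
    have hlt : sInf (MicroAux.AssouadSet F) < η + ε := by
      rw [hη, hset]
      have : (0 : ℝ) < ε := hε
      linarith
    obtain ⟨s, hs, hsε⟩ := exists_lt_of_csInf_lt (MicroAux.assouadSet_nonempty F hF) hlt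
    calc dimH A ≤ ENNReal.ofReal s := MicroAux.dimH_micro hF hs hA
      _ ≤ ENNReal.ofReal (η + ε) := ENNReal.ofReal_le_ofReal hsε.le
      _ ≤ ENNReal.ofReal η + ENNReal.ofReal ε := ENNReal.ofReal_add_le
      _ = ENNReal.ofReal η + ε := by rw [ENNReal.ofReal_coe_nnreal]
  · have h0 : 0 ≤ η := by
      rw [hη]
      exact Real.sInf_nonneg fun s hs => hs.1
    rcases h0.eq_or_lt with h | h
    · obtain ⟨E, hE⟩ := MicroAux.exists_weakTangent hF hFne
      refine ⟨E, hE, ?_⟩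
      unfold hausdorffContent
      refine le_iInf₂ fun U _ => ?_
      rw [← h]
      refine le_trans ?_ (ENNReal.le_tsum 0)
      simp
    · by_contra hcon
      push Not at hcon
      exact MicroAux.content_part hF h hη hcon
end

section
/- Let B ⊂ ℝ be compact with positive lower box dimension and consider the product [0,1] × B ⊂ ℝ². Then the Hausdorff dimension of the image of [0,1] × B under any quasisymmetric homeomorphism of ℝ² is at least dim_H([0,1] × B); in particular, if dim_H([0,1] × B) = 1 + dim_H B, the set [0,1] × B is minimal for conformal Hausdorff dimension. -/
open Filter

/-- The lower box dimension of a bounded set of reals. -/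
noncomputable def lowerBoxDim (B : Set ℝ) : ℝ :=
  Filter.liminf
    (fun k : ℕ => Real.log (coverNum ((2:ℝ) ^ (-(k:ℝ))) B) / ((k : ℝ) * Real.log 2))
    Filter.atTop

/-- `f` is a quasisymmetry: there is an increasing homeomorphism `η` of `[0,∞)` with
`d(f x, f y)/d(f x, f z) ≤ η(d(x,y)/d(x,z))` for all `x ≠ z`. -/
def IsQuasisymmetry {X Y : Type*} [MetricSpace X] [MetricSpace Y] (f : X → Y) : Prop :=
  ∃ η : ℝ → ℝ, StrictMonoOn η (Set.Ici 0) ∧ ContinuousOn η (Set.Ici 0) ∧ η 0 = 0 ∧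
    Tendsto η atTop atTop ∧ (∀ t, 0 ≤ t → 0 ≤ η t) ∧
    ∀ x y z : X, x ≠ z → dist (f x) (f y) ≤ η (dist x y / dist x z) * dist (f x) (f z)

namespace QSProof

open MeasureTheory Metric Set Topology
open scoped ENNReal NNReal

/-- Squares at scale `2^{-k}`. -/
def Tsq (k m : ℕ) (j : ℤ) : Set (ℝ × ℝ) :=
  Metric.closedBall ((m:ℝ) / 2 ^ k, (j:ℝ) / 2 ^ k) (2 / 2 ^ k)

/-- Slightly larger squares at scale `2^{-k}`. -/
def Rsq (k m : ℕ) (j : ℤ) : Set (ℝ × ℝ) :=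
  Metric.closedBall ((m:ℝ) / 2 ^ k, (j:ℝ) / 2 ^ k) (3 / 2 ^ k)

lemma ediam_Rsq_le (k m : ℕ) (j : ℤ) : ediam (Rsq k m j) ≤ 6 / 2 ^ k := by
  have h : ediam (Rsq k m j) ≤ ENNReal.ofReal (6 / 2 ^ k) := by
    apply Metric.ediam_le_of_forall_dist_le
    intro x hx y hy
    have h1 : dist x _ ≤ _ := hx
    have h2 : dist y _ ≤ _ := hy
    have h3 := dist_triangle_right x y (((m:ℝ) / 2 ^ k, (j:ℝ) / 2 ^ k) : ℝ × ℝ)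
    have h4 : (6:ℝ) / 2 ^ k = 3 / 2 ^ k + 3 / 2 ^ k := by ring
    linarith
  refine h.trans_eq ?_
  rw [ENNReal.ofReal_div_of_pos (by positivity), ENNReal.ofReal_pow (by norm_num)]
  simp

lemma Tsq_exists (p : ℝ × ℝ) (h0 : 0 ≤ p.1) (h1 : p.1 ≤ 1) (k : ℕ) :
    ∃ m : ℕ, ∃ j : ℤ, m ∈ Finset.range (2 ^ k + 1) ∧
      Metric.closedBall p (1 / 2 ^ k) ⊆ Tsq k m j ∧
      Tsq k m j ⊆ Metric.closedBall p (3 / 2 ^ k) := by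
  have hk : (0:ℝ) < 2 ^ k := by positivity
  set m : ℕ := ⌊p.1 * 2 ^ k⌋₊ with hm
  set j : ℤ := ⌊p.2 * 2 ^ k⌋ with hj
  have a1 : (m:ℝ) ≤ p.1 * 2 ^ k := Nat.floor_le (by positivity)
  have a2 : p.1 * 2 ^ k < m + 1 := Nat.lt_floor_add_one _
  have b1 : (j:ℝ) ≤ p.2 * 2 ^ k := Int.floor_le _
  have b2 : p.2 * 2 ^ k < j + 1 := Int.lt_floor_add_one _
  have hd : dist p (((m:ℝ) / 2 ^ k, (j:ℝ) / 2 ^ k) : ℝ × ℝ) ≤ 1 / 2 ^ k := by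
    rw [Prod.dist_eq, max_le_iff, Real.dist_eq, Real.dist_eq]
    have e1 : p.1 = p.1 * 2 ^ k / 2 ^ k := by field_simp
    have e2 : p.2 = p.2 * 2 ^ k / 2 ^ k := by field_simp
    constructor
    · simp only
      rw [e1, ← sub_div, abs_div, abs_of_pos hk]
      gcongr
      rw [abs_le]; constructor <;> linarith
    · simp only
      rw [e2, ← sub_div, abs_div, abs_of_pos hk]
      gcongr
      rw [abs_le]; constructor <;> linarith
  refine ⟨m, j, ?_, ?_, ?_⟩
  · rw [Finset.mem_range, Nat.lt_succ_iff]
    have : (m:ℝ) ≤ ((2 ^ k : ℕ):ℝ) := by push_cast; nlinarith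
    exact_mod_cast this
  · apply Metric.closedBall_subset_closedBall'
    have : (2:ℝ) / 2 ^ k = 1 / 2 ^ k + 1 / 2 ^ k := by ring
    linarith
  · apply Metric.closedBall_subset_closedBall'
    rw [dist_comm]
    have : (3:ℝ) / 2 ^ k = 2 / 2 ^ k + 1 / 2 ^ k := by ring
    linarith

lemma Tsq_offset {k m : ℕ} {j : ℤ} {x y : ℝ} (h : (x, y) ∈ Tsq k m j) :
    j - ⌊y * 2 ^ k⌋ ∈ Finset.Icc (-2:ℤ) 2 := by
  have hk : (0:ℝ) < 2 ^ k := by positivity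
  have h1 : dist (x, y) (((m:ℝ) / 2 ^ k, (j:ℝ) / 2 ^ k) : ℝ × ℝ) ≤ 2 / 2 ^ k := h
  rw [Prod.dist_eq, max_le_iff, Real.dist_eq, Real.dist_eq] at h1
  have h2 := h1.2
  simp only at h2
  have e2 : y = y * 2 ^ k / 2 ^ k := by field_simp
  rw [e2, ← sub_div, abs_div, abs_of_pos hk, div_le_div_iff_of_pos_right hk, abs_le] at h2
  have b1 := Int.floor_le (y * 2 ^ k)
  have b2 := Int.lt_floor_add_one (y * 2 ^ k)
  rw [Finset.mem_Icc]
  constructor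
  · have : ((-3 : ℤ) : ℝ) < ((j - ⌊y * 2 ^ k⌋ : ℤ) : ℝ) := by push_cast; linarith
    have := Int.cast_lt.1 this
    omega
  · have : ((j - ⌊y * 2 ^ k⌋ : ℤ) : ℝ) < ((3 : ℤ) : ℝ) := by push_cast; linarith
    have := Int.cast_lt.1 this
    omega

lemma Tsq_cover {k : ℕ} {o : ℤ} {x y : ℝ} (h0 : 0 ≤ x) (h1 : x ≤ 1)
    (ho : o ∈ Finset.Icc (-2:ℤ) 2) :
    ∃ m ∈ Finset.range (2 ^ k + 1), (x, y) ∈ Rsq k m (⌊y * 2 ^ k⌋ + o) := by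
  have hk : (0:ℝ) < 2 ^ k := by positivity
  have a1 : ((⌊x * 2 ^ k⌋₊ : ℕ):ℝ) ≤ x * 2 ^ k := Nat.floor_le (by positivity)
  have a2 : x * 2 ^ k < (⌊x * 2 ^ k⌋₊ : ℕ) + 1 := Nat.lt_floor_add_one _
  have b1 := Int.floor_le (y * 2 ^ k)
  have b2 := Int.lt_floor_add_one (y * 2 ^ k)
  refine ⟨⌊x * 2 ^ k⌋₊, ?_, ?_⟩
  · rw [Finset.mem_range, Nat.lt_succ_iff]
    have : ((⌊x * 2 ^ k⌋₊ : ℕ):ℝ) ≤ ((2 ^ k : ℕ):ℝ) := by push_cast; nlinarith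
    exact_mod_cast this
  · rw [Finset.mem_Icc] at ho
    have o1 : (-2:ℝ) ≤ o := by exact_mod_cast ho.1
    have o2 : (o:ℝ) ≤ 2 := by exact_mod_cast ho.2
    rw [Rsq, Metric.mem_closedBall, Prod.dist_eq, max_le_iff, Real.dist_eq, Real.dist_eq]
    have e1 : x = x * 2 ^ k / 2 ^ k := by field_simp
    have e2 : y = y * 2 ^ k / 2 ^ k := by field_simp
    constructor
    · simp only
      nth_rewrite 1 [e1]
      rw [← sub_div, abs_div, abs_of_pos hk]
      gcongr
      rw [abs_le]; constructor <;> linarith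
    · simp only
      nth_rewrite 1 [e2]
      rw [← sub_div, abs_div, abs_of_pos hk]
      gcongr
      push_cast
      rw [abs_le]; constructor <;> linarith

lemma line_le {ι : Type*} [Countable ι] {f : ℝ × ℝ → ℝ × ℝ} (hf : Continuous f) (y : ℝ)
    (s : ι → Set (ℝ × ℝ)) (hs : ∀ x ∈ Icc (0:ℝ) 1, ∃ i, (x, y) ∈ s i) :
    edist (f (0, y)) (f (1, y)) ≤ ∑' i, ediam (f '' s i) := by
  set φ : ℝ × ℝ → ℝ := fun p => dist (f (0, y)) p with hφ
  have hL : LipschitzWith 1 φ := LipschitzWith.dist_right _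
  have hc : ContinuousOn (fun x : ℝ => φ (f (x, y))) (Icc 0 1) := by
    apply Continuous.continuousOn
    fun_prop
  have hI := intermediate_value_Icc zero_le_one hc
  have h2 : Icc (0:ℝ) (dist (f (0, y)) (f (1, y))) ⊆ ⋃ i, φ '' (f '' s i) := by
    intro t ht
    have : t ∈ Icc (φ (f (0, y))) (φ (f (1, y))) := by simpa [hφ] using ht
    obtain ⟨x, hx, rfl⟩ := hI this
    obtain ⟨i, hi⟩ := hs x hx
    exact mem_iUnion.2 ⟨i, mem_image_of_mem _ (mem_image_of_mem _ hi)⟩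
  calc edist (f (0, y)) (f (1, y)) = volume (Icc (0:ℝ) (dist (f (0, y)) (f (1, y)))) := by
        rw [Real.volume_Icc, edist_dist, sub_zero]
    _ ≤ volume (⋃ i, φ '' (f '' s i)) := measure_mono h2
    _ ≤ ∑' i, volume (φ '' (f '' s i)) := measure_iUnion_le _
    _ ≤ ∑' i, ediam (f '' s i) := by
        apply ENNReal.tsum_le_tsum
        intro i
        refine (Real.volume_le_diam _).trans ?_
        simpa using hL.ediam_image_le (f '' s i)

lemma one_le_dim {f : ℝ × ℝ → ℝ × ℝ} (hf : Continuous f) (hinj : Function.Injective f)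
    (X : Set (ℝ × ℝ)) (y : ℝ) (hs : ∀ x ∈ Icc (0:ℝ) 1, (x, y) ∈ X) :
    1 ≤ dimH (f '' X) := by
  set φ : ℝ × ℝ → ℝ := fun p => dist (f (0, y)) p with hφ
  have hL : LipschitzWith 1 φ := LipschitzWith.dist_right _
  have hc : ContinuousOn (fun x : ℝ => φ (f (x, y))) (Icc 0 1) := by
    apply Continuous.continuousOn
    fun_prop
  have hI := intermediate_value_Icc zero_le_one hc
  have h2 : Icc (0:ℝ) (dist (f (0, y)) (f (1, y))) ⊆ φ '' (f '' X) := by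
    intro t ht
    have : t ∈ Icc (φ (f (0, y))) (φ (f (1, y))) := by simpa [hφ] using ht
    obtain ⟨x, hx, rfl⟩ := hI this
    exact (mem_image_of_mem _ (mem_image_of_mem _ (hs x hx)))
  have hpos : 0 < dist (f (0, y)) (f (1, y)) := by
    rw [dist_pos]
    intro h
    have := hinj h
    simp at this
  have h3 : dimH (Icc (0:ℝ) (dist (f (0, y)) (f (1, y)))) = 1 := by
    have := Real.dimH_of_nonempty_interior (E := ℝ)
      (s := Icc (0:ℝ) (dist (f (0, y)) (f (1, y)))) (by
        rw [interior_Icc]; exact nonempty_Ioo.2 hpos)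
    simpa using this
  rw [← h3]
  exact (dimH_mono h2).trans (hL.dimH_image_le _)

lemma qs_square {f : ℝ × ℝ → ℝ × ℝ} (hf : Continuous f) (hq : IsQuasisymmetry f) :
    ∃ C : ℝ≥0, ∀ V : Set (ℝ × ℝ), V.Nonempty → (∀ p ∈ V, 0 ≤ p.1 ∧ p.1 ≤ 1) →
      (∀ p ∈ V, ∀ z ∈ V, dist p z ≤ 1) → ∀ ε : ℝ≥0∞, 0 < ε →
      ∃ k m : ℕ, ∃ j : ℤ, m ∈ Finset.range (2 ^ k + 1) ∧ V ⊆ Tsq k m j ∧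
        ediam (f '' Tsq k m j) ≤ max (C * ediam (f '' V)) ε := by
  obtain ⟨η, hmono, -, -, -, hnn, hη⟩ := hq
  refine ⟨(2 * η 18).toNNReal, ?_⟩
  intro V hne hV hd ε hε
  obtain ⟨p, hp⟩ := hne
  have hbd : Bornology.IsBounded V := Metric.isBounded_iff.2 ⟨1, fun x hx y hy => hd x hx y hy⟩
  rcases (Metric.diam_nonneg (s := V)).eq_or_lt with h0 | h0
  · -- singleton
    have hsub : V ⊆ {p} := by
      intro z hz
      have := Metric.dist_le_diam_of_mem hbd hz hp
      rw [← h0] at this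
      exact dist_le_zero.1 this
    have hcont : ∀ᶠ r : ℝ in 𝓝 0, f '' (Metric.closedBall p r) ⊆ Metric.eball (f p) (ε / 2) := by
      have : f ⁻¹' (Metric.eball (f p) (ε / 2)) ∈ 𝓝 p :=
        hf.continuousAt.preimage_mem_nhds (Metric.eball_mem_nhds _ (ENNReal.half_pos hε.ne'))
      obtain ⟨r, hr, hrs⟩ := Metric.mem_nhds_iff.1 this
      filter_upwards [gt_mem_nhds hr] with t ht
      rw [image_subset_iff]
      exact (Metric.closedBall_subset_ball ht).trans hrs
    have ht : Tendsto (fun k : ℕ => (3:ℝ) / 2 ^ k) atTop (𝓝 0) := by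
      have := (tendsto_pow_atTop_nhds_zero_of_lt_one (r := (1/2:ℝ)) (by norm_num)
        (by norm_num)).const_mul 3
      simp only [mul_zero] at this
      refine this.congr fun k => ?_
      rw [one_div, inv_pow]; rfl
    obtain ⟨k, hk⟩ := (ht.eventually hcont).exists
    obtain ⟨m, j, hm, h1, h2⟩ := Tsq_exists p (hV p hp).1 (hV p hp).2 k
    refine ⟨k, m, j, hm, ?_, ?_⟩
    · refine hsub.trans ((singleton_subset_iff.2 ?_).trans h1)
      exact Metric.mem_closedBall_self (by positivity)
    · refine le_max_of_le_right ?_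
      have h3 : f '' Tsq k m j ⊆ Metric.eball (f p) (ε / 2) := (image_mono h2).trans hk
      apply Metric.ediam_le
      intro u hu v hv
      have hu' : edist u (f p) < ε / 2 := h3 hu
      have hv' : edist v (f p) < ε / 2 := h3 hv
      calc edist u v ≤ edist u (f p) + edist v (f p) := edist_triangle_right _ _ _
        _ ≤ ε / 2 + ε / 2 := add_le_add hu'.le hv'.le
        _ = ε := ENNReal.add_halves ε
  · set d := Metric.diam V with hdd
    have hd1 : d ≤ 1 := Metric.diam_le_of_forall_dist_le zero_le_one hd
    obtain ⟨k, hk1, hk2⟩ := exists_nat_pow_near_of_lt_one h0 hd1 (y := (1/2:ℝ)) (by norm_num)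
      (by norm_num)
    obtain ⟨m, j, hm, h1, h2⟩ := Tsq_exists p (hV p hp).1 (hV p hp).2 k
    obtain ⟨z, hz, hpz⟩ : ∃ z ∈ V, d / 3 ≤ dist p z := by
      by_contra! hcon
      have : d ≤ 2 * (d / 3) := by
        apply Metric.diam_le_of_forall_dist_le (by positivity)
        intro u hu v hv
        have := dist_triangle_left u v p
        have := hcon u hu
        have := hcon v hv
        linarith
      linarith
    have hpz0 : 0 < dist p z := by linarith
    have hkk : (1/2:ℝ) ^ k = 1 / 2 ^ k := by rw [div_pow, one_pow]
    have hk3 : (1:ℝ) / 2 ^ k < 2 * d := by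
      rw [pow_succ, hkk] at hk1; linarith
    have key : ∀ w ∈ Tsq k m j, dist (f p) (f w) ≤ η 18 * dist (f p) (f z) := by
      intro w hw
      have h3 : dist w p ≤ 3 / 2 ^ k := h2 hw
      refine (hη p w z (dist_pos.1 hpz0)).trans ?_
      gcongr
      apply hmono.monotoneOn
      · exact div_nonneg dist_nonneg dist_nonneg
      · simp
      · rw [div_le_iff₀ hpz0, dist_comm]
        have : (3:ℝ) / 2 ^ k = 3 * (1 / 2 ^ k) := by ring
        linarith
    refine ⟨k, m, j, hm, ?_, le_max_of_le_left ?_⟩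
    · refine fun u hu => h1 ?_
      rw [Metric.mem_closedBall, ← hkk]
      exact (Metric.dist_le_diam_of_mem hbd hu hp).trans hk2
    · have h18 : 0 ≤ η 18 := hnn 18 (by norm_num)
      have hA : ediam (f '' Tsq k m j) ≤ ENNReal.ofReal (2 * η 18 * dist (f p) (f z)) := by
        apply Metric.ediam_le_of_forall_dist_le
        rintro _ ⟨u, hu, rfl⟩ _ ⟨v, hv, rfl⟩
        have := dist_triangle_left (f u) (f v) (f p)
        have := key u hu
        have := key v hv
        linarith
      refine hA.trans ?_
      rw [ENNReal.ofReal_mul (by positivity), ← edist_dist]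
      exact mul_le_mul_right (Metric.edist_le_ediam_of_mem (mem_image_of_mem _ hp)
        (mem_image_of_mem _ hz)) _

lemma hausdorff_zero_of_covers {ι : Type*} [Countable ι] (X : Set (ℝ × ℝ)) (d : ℝ) (hd : 0 < d)
    (h : ∀ ε : ℝ≥0∞, 0 < ε → ∃ t : ι → Set (ℝ × ℝ), X ⊆ ⋃ i, t i ∧ ∑' i, ediam (t i) ^ d ≤ ε) :
    μH[d] X = 0 := by
  have hpos : ∀ n : ℕ, (0:ℝ≥0∞) < ((n:ℝ≥0∞) + 1)⁻¹ := fun n => by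
    rw [ENNReal.inv_pos]; exact ENNReal.add_ne_top.2 ⟨ENNReal.natCast_ne_top n, ENNReal.one_ne_top⟩
  choose t ht1 ht2 using fun n : ℕ => h (((n:ℝ≥0∞) + 1)⁻¹) (hpos n)
  have hlim : Tendsto (fun n : ℕ => ((n:ℝ≥0∞) + 1)⁻¹) atTop (𝓝 0) := by
    have := (tendsto_add_atTop_iff_nat 1).2 ENNReal.tendsto_inv_nat_nhds_zero
    simpa using this
  have hr : Tendsto (fun n : ℕ => (((n:ℝ≥0∞) + 1)⁻¹) ^ (d⁻¹)) atTop (𝓝 0) := by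
    have := (ENNReal.continuous_rpow_const (y := d⁻¹)).tendsto 0
    rw [ENNReal.zero_rpow_of_pos (inv_pos.2 hd)] at this
    exact this.comp hlim
  have := Measure.hausdorffMeasure_le_liminf_tsum (ι := fun _ : ℕ => ι) d X _ hr t
    (Eventually.of_forall fun n i => by
      rw [ENNReal.le_rpow_inv_iff hd]
      exact (ENNReal.le_tsum i).trans (ht2 n))
    (Eventually.of_forall ht1)
  refine le_antisymm (this.trans ?_) bot_le
  calc liminf (fun n => ∑' i, ediam (t n i) ^ d) atTop ≤
      liminf (fun n : ℕ => ((n:ℝ≥0∞) + 1)⁻¹) atTop := liminf_le_liminf (Eventually.of_forall ht2)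
    _ = 0 := hlim.liminf_eq

lemma two_pow_add_one_le (k : ℕ) : (((2 ^ k + 1 : ℕ)) : ℝ≥0∞) ≤ 2 * 2 ^ k := by
  have : (2 ^ k + 1 : ℕ) ≤ 2 * 2 ^ k := by
    have := Nat.one_le_two_pow (n := k)
    omega
  exact_mod_cast this

lemma pigeon (q q' : ℝ) (hq : 1 ≤ q) (hqq : q < q') (c : ℝ≥0∞) (hc : c ≠ 0) (hc' : c ≠ ⊤) :
    ∃ c2 : ℝ≥0∞, c2 ≠ 0 ∧ c2 ≠ ⊤ ∧ ∀ (b : ℕ → ℕ → ℤ → ℝ≥0∞) (y : ℝ),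
      c ≤ ∑' k : ℕ, ∑ o ∈ Finset.Icc (-2:ℤ) 2, ∑ m ∈ Finset.range (2 ^ k + 1),
        b k m (⌊y * 2 ^ k⌋ + o) →
      ∃ k : ℕ, ∃ o ∈ Finset.Icc (-2:ℤ) 2,
        c2 * ((2:ℝ≥0∞) ^ k) ^ (-(q' - 1)) ≤
          ∑ m ∈ Finset.range (2 ^ k + 1), b k m (⌊y * 2 ^ k⌋ + o) ^ q := by
  have hq0 : 0 < q := by linarith
  set r : ℝ≥0∞ := (2:ℝ≥0∞) ^ (-((q' - q) / q)) with hr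
  have hθ : 0 < (q' - q) / q := div_pos (by linarith) hq0
  have hr1 : r < 1 := by
    rw [hr, ENNReal.rpow_neg, ENNReal.inv_lt_one]
    exact ENNReal.one_lt_rpow (by norm_num) hθ
  set K : ℝ≥0∞ := (1 - r)⁻¹ with hK
  have hK0 : K ≠ 0 := by
    rw [hK]; exact ENNReal.inv_ne_zero.2 (ENNReal.sub_ne_top ENNReal.one_ne_top)
  have hKt : K ≠ ⊤ := by
    rw [hK]; exact ENNReal.inv_ne_top.2 (tsub_pos_of_lt hr1).ne'
  set c1 : ℝ≥0∞ := c / (10 * K) with hc1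
  have h10K : 10 * K ≠ ⊤ := ENNReal.mul_ne_top (by norm_num) hKt
  have h10K0 : 10 * K ≠ 0 := mul_ne_zero (by norm_num) hK0
  have hc10 : c1 ≠ 0 := (ENNReal.div_pos hc h10K).ne'
  have hc1t : c1 ≠ ⊤ := ENNReal.div_ne_top hc' h10K0
  have h2t : (2:ℝ≥0∞) ^ (q - 1) ≠ ⊤ := ENNReal.rpow_ne_top_of_nonneg (by linarith) (by norm_num)
  have h20 : (2:ℝ≥0∞) ^ (q - 1) ≠ 0 := (ENNReal.rpow_pos (by norm_num) (by norm_num)).ne'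
  refine ⟨c1 ^ q / 2 ^ (q - 1), ?_, ?_, ?_⟩
  · exact (ENNReal.div_pos (ENNReal.rpow_pos (pos_iff_ne_zero.2 hc10) hc1t).ne' h2t).ne'
  · exact ENNReal.div_ne_top (ENNReal.rpow_ne_top_of_nonneg hq0.le hc1t) h20
  intro b y hb
  by_contra! hcon
  have hW : ∀ k : ℕ, ∀ o ∈ Finset.Icc (-2:ℤ) 2,
      ∑ m ∈ Finset.range (2 ^ k + 1), b k m (⌊y * 2 ^ k⌋ + o) ≤ c1 * r ^ k := by
    intro k o ho
    rw [← ENNReal.rpow_le_rpow_iff hq0]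
    have hp0 : (2:ℝ≥0∞) ^ k ≠ 0 := pow_ne_zero _ (by norm_num)
    have hpt : (2:ℝ≥0∞) ^ k ≠ ⊤ := ENNReal.pow_ne_top (by norm_num)
    have hrk : (r ^ k) ^ q = ((2:ℝ≥0∞) ^ k) ^ (q - 1) * ((2:ℝ≥0∞) ^ k) ^ (-(q' - 1)) := by
      rw [← ENNReal.rpow_add _ _ hp0 hpt, hr, ← ENNReal.rpow_natCast, ← ENNReal.rpow_natCast,
        ← ENNReal.rpow_mul, ← ENNReal.rpow_mul, ← ENNReal.rpow_mul]
      congr 1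
      field_simp
      ring
    calc (∑ m ∈ Finset.range (2 ^ k + 1), b k m (⌊y * 2 ^ k⌋ + o)) ^ q
        ≤ ((Finset.range (2 ^ k + 1)).card : ℝ≥0∞) ^ (q - 1) *
          ∑ m ∈ Finset.range (2 ^ k + 1), b k m (⌊y * 2 ^ k⌋ + o) ^ q :=
          ENNReal.rpow_sum_le_const_mul_sum_rpow _ _ hq
      _ ≤ (2 * 2 ^ k) ^ (q - 1) * (c1 ^ q / 2 ^ (q - 1) * ((2:ℝ≥0∞) ^ k) ^ (-(q' - 1))) := by
          rw [Finset.card_range]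
          exact mul_le_mul' (ENNReal.rpow_le_rpow (two_pow_add_one_le k) (by linarith))
            (hcon k o ho).le
      _ = (2 ^ (q - 1) * (c1 ^ q / 2 ^ (q - 1))) *
            (((2:ℝ≥0∞) ^ k) ^ (q - 1) * ((2:ℝ≥0∞) ^ k) ^ (-(q' - 1))) := by
          rw [ENNReal.mul_rpow_of_nonneg _ _ (by linarith)]; ring
      _ = (c1 * r ^ k) ^ q := by
          rw [ENNReal.mul_div_cancel h20 h2t, ENNReal.mul_rpow_of_nonneg _ _ hq0.le, hrk]
  have hfin : c ≤ c / 2 := by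
    calc c ≤ _ := hb
      _ ≤ ∑' k : ℕ, ∑ o ∈ Finset.Icc (-2:ℤ) 2, c1 * r ^ k :=
        ENNReal.tsum_le_tsum fun k => Finset.sum_le_sum (hW k)
      _ = ∑' k : ℕ, (5 * c1) * r ^ k := by
        congr 1; ext k
        rw [Finset.sum_const]
        simp [mul_assoc]
      _ = 5 * c1 * K := by rw [ENNReal.tsum_mul_left, ENNReal.tsum_geometric]
      _ = c / 2 := by
        rw [hc1, ENNReal.div_eq_inv_mul, ENNReal.mul_inv (by simp) (by simp)]
        have e1 : K⁻¹ * K = 1 := ENNReal.inv_mul_cancel hK0 hKt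
        have e2 : (5:ℝ≥0∞) * 10⁻¹ = 2⁻¹ := by
          rw [show (10:ℝ≥0∞) = 5 * 2 by norm_num, ENNReal.mul_inv (by simp) (by simp), ← mul_assoc,
            ENNReal.mul_inv_cancel (by norm_num) (by norm_num), one_mul]
        calc 5 * (10⁻¹ * K⁻¹ * c) * K = (5 * 10⁻¹) * (K⁻¹ * K) * c := by ring
          _ = c / 2 := by rw [e1, e2, mul_one, ENNReal.div_eq_inv_mul]
  exact absurd hfin (not_le.2 (ENNReal.half_lt_self hc hc'))

open Classical in
lemma cover_sum (q q' : ℝ) (hq' : 1 < q') (c2 : ℝ≥0∞) (hc0 : c2 ≠ 0) (hct : c2 ≠ ⊤)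
    (b : ℕ → ℕ → ℤ → ℝ≥0∞) :
    ∑' i : ℕ × ℤ × ℕ, ediam (if (c2 * ((2:ℝ≥0∞) ^ i.1) ^ (-(q' - 1)) ≤
          ∑ m ∈ Finset.range (2 ^ i.1 + 1), b i.1 m i.2.1 ^ q) ∧ i.2.2 ∈ Finset.range (2 ^ i.1 + 1)
        then Rsq i.1 i.2.2 i.2.1 else ∅) ^ q' ≤
      (2 * 6 ^ q' / c2) * ∑' i : ℕ × ℤ × ℕ, b i.1 i.2.2 i.2.1 ^ q := by
  have hq0 : 0 < q' := by linarith
  rw [ENNReal.tsum_prod', ENNReal.tsum_prod', ← ENNReal.tsum_mul_left]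
  refine ENNReal.tsum_le_tsum fun k => ?_
  rw [ENNReal.tsum_prod', ENNReal.tsum_prod', ← ENNReal.tsum_mul_left]
  refine ENNReal.tsum_le_tsum fun j => ?_
  simp only
  have hp0 : (2:ℝ≥0∞) ^ k ≠ 0 := pow_ne_zero _ (by norm_num)
  have hpt : (2:ℝ≥0∞) ^ k ≠ ⊤ := ENNReal.pow_ne_top (by norm_num)
  by_cases hg : c2 * ((2:ℝ≥0∞) ^ k) ^ (-(q' - 1)) ≤
          ∑ m ∈ Finset.range (2 ^ k + 1), b k m j ^ q
  · rw [tsum_eq_sum (s := Finset.range (2 ^ k + 1))]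
    · calc _ ≤ ∑ m ∈ Finset.range (2 ^ k + 1), ((6:ℝ≥0∞) / 2 ^ k) ^ q' := by
            refine Finset.sum_le_sum fun m hm => ?_
            rw [if_pos ⟨hg, hm⟩]
            exact ENNReal.rpow_le_rpow (ediam_Rsq_le k m j) hq0.le
        _ ≤ (2 * 2 ^ k) * ((6:ℝ≥0∞) / 2 ^ k) ^ q' := by
            rw [Finset.sum_const, Finset.card_range, nsmul_eq_mul]
            exact mul_le_mul' (two_pow_add_one_le k) le_rfl
        _ = 2 * 6 ^ q' * ((2:ℝ≥0∞) ^ k) ^ (-(q' - 1)) := by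
            rw [ENNReal.div_rpow_of_nonneg _ _ hq0.le, div_eq_mul_inv, ← ENNReal.rpow_neg,
              show -(q' - 1) = 1 + -q' by ring, ENNReal.rpow_add _ _ hp0 hpt, ENNReal.rpow_one]
            ring
        _ = 2 * 6 ^ q' / c2 * (c2 * ((2:ℝ≥0∞) ^ k) ^ (-(q' - 1))) := by
            rw [← mul_assoc, ENNReal.div_mul_cancel hc0 hct]
        _ ≤ 2 * 6 ^ q' / c2 * ∑ m ∈ Finset.range (2 ^ k + 1), b k m j ^ q :=
            mul_le_mul' le_rfl hg
        _ ≤ _ := mul_le_mul' le_rfl (ENNReal.sum_le_tsum _)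
    · intro m hm
      rw [if_neg (fun h => hm h.2)]
      simp [hq0]
  · have : ∀ m : ℕ, ediam (if (c2 * ((2:ℝ≥0∞) ^ k) ^ (-(q' - 1)) ≤
          ∑ m ∈ Finset.range (2 ^ k + 1), b k m j ^ q) ∧ m ∈ Finset.range (2 ^ k + 1)
        then Rsq k m j else ∅) ^ q' = 0 := by
      intro m
      rw [if_neg (fun h => hg h.1)]
      simp [hq0]
    simp only [this, tsum_zero]
    exact bot_le

open Classical in
lemma line_sum {f : ℝ × ℝ → ℝ × ℝ} (hf : Continuous f) (y : ℝ) (b : ℕ → ℕ → ℤ → ℝ≥0∞)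
    (h : ∀ x ∈ Icc (0:ℝ) 1, ∃ k : ℕ, ∃ m ∈ Finset.range (2 ^ k + 1), ∃ j : ℤ,
      (x, y) ∈ Tsq k m j ∧ ediam (f '' Tsq k m j) ≤ b k m j) :
    edist (f (0, y)) (f (1, y)) ≤ ∑' k : ℕ, ∑ o ∈ Finset.Icc (-2:ℤ) 2,
      ∑ m ∈ Finset.range (2 ^ k + 1), b k m (⌊y * 2 ^ k⌋ + o) := by
  set s : ℕ × ℤ × ℕ → Set (ℝ × ℝ) := fun i =>
    if (i.2.1 ∈ Finset.Icc (-2:ℤ) 2 ∧ i.2.2 ∈ Finset.range (2 ^ i.1 + 1)) ∧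
      ediam (f '' Tsq i.1 i.2.2 (⌊y * 2 ^ i.1⌋ + i.2.1)) ≤ b i.1 i.2.2 (⌊y * 2 ^ i.1⌋ + i.2.1)
    then Tsq i.1 i.2.2 (⌊y * 2 ^ i.1⌋ + i.2.1) else ∅ with hs
  have h1 := line_le hf y s (by
    intro x hx
    obtain ⟨k, m, hm, j, hT, hb⟩ := h x hx
    refine ⟨(k, j - ⌊y * 2 ^ k⌋, m), ?_⟩
    have e : ⌊y * 2 ^ k⌋ + (j - ⌊y * 2 ^ k⌋) = j := by ring
    simp only [hs, e]
    rw [if_pos ⟨⟨Tsq_offset hT, hm⟩, hb⟩]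
    exact hT)
  refine h1.trans ?_
  rw [ENNReal.tsum_prod']
  refine ENNReal.tsum_le_tsum fun k => ?_
  rw [ENNReal.tsum_prod', tsum_eq_sum (s := Finset.Icc (-2:ℤ) 2)]
  · refine Finset.sum_le_sum fun o ho => ?_
    rw [tsum_eq_sum (s := Finset.range (2 ^ k + 1))]
    · refine Finset.sum_le_sum fun m hm => ?_
      simp only [hs]
      split_ifs with hh
      · exact hh.2
      · simp
    · intro m hm
      simp only [hs]
      rw [if_neg (fun hh => hm hh.1.2)]
      simp
  · intro o ho
    rw [ENNReal.tsum_eq_zero]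
    intro m
    simp only [hs]
    rw [if_neg (fun hh => ho hh.1.1)]
    simp

open Classical in
lemma main_zero (B : Set ℝ) (hB : IsCompact B) (hBne : B.Nonempty)
    (f : Homeomorph (ℝ × ℝ) (ℝ × ℝ)) (hf : IsQuasisymmetry ⇑f) (q q' : ℝ) (hq : 1 ≤ q)
    (hqq : q < q') (hz : μH[q] (⇑f '' (Set.Icc (0:ℝ) 1 ×ˢ B)) = 0) :
    μH[q'] (Set.Icc (0:ℝ) 1 ×ˢ B) = 0 := by
  have hq0 : 0 < q := by linarith
  have hq'0 : 0 < q' := by linarith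
  set X : Set (ℝ × ℝ) := Set.Icc (0:ℝ) 1 ×ˢ B with hX
  have hfc : Continuous f := f.continuous
  have hXc : IsCompact X := isCompact_Icc.prod hB
  obtain ⟨y0, hy0, hmin⟩ := hB.exists_isMinOn hBne
    (f := fun y : ℝ => edist (f (0, y)) (f (1, y))) (by
      apply Continuous.continuousOn
      fun_prop)
  set c : ℝ≥0∞ := edist (f (0, y0)) (f (1, y0)) with hc
  have hc0 : c ≠ 0 := by
    rw [hc, Ne, edist_eq_zero]
    intro h
    have := f.injective h
    simp at this
  have hct : c ≠ ⊤ := edist_ne_top _ _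
  obtain ⟨c2, hc20, hc2t, hpig⟩ := pigeon q q' hq hqq c hc0 hct
  obtain ⟨C, hC⟩ := qs_square hfc hf
  -- uniform continuity of the inverse
  obtain ⟨r, hr0, hr⟩ : ∃ r : ℝ≥0∞, 0 < r ∧ ∀ p ∈ X, ∀ z ∈ X, edist (f p) (f z) ≤ r →
      dist p z ≤ 1 := by
    have huc : UniformContinuousOn f.symm (f '' X) :=
      (hXc.image hfc).uniformContinuousOn_of_continuous f.symm.continuous.continuousOn
    obtain ⟨δ, hδ, h⟩ := Metric.uniformContinuousOn_iff.1 huc 1 one_pos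
    refine ⟨ENNReal.ofReal (δ / 2), ENNReal.ofReal_pos.2 (by positivity), ?_⟩
    intro p hp z hz' hpz
    have h2 := h (f p) (mem_image_of_mem _ hp) (f z) (mem_image_of_mem _ hz') (by
      rw [edist_dist, ENNReal.ofReal_le_ofReal_iff (by positivity)] at hpz
      linarith)
    simpa using h2.le
  apply hausdorff_zero_of_covers (ι := ℕ × ℤ × ℕ) X q' hq'0
  intro ε hε
  set A : ℝ≥0∞ := 2 * 6 ^ q' / c2 with hA
  have hAt : A ≠ ⊤ := ENNReal.div_ne_top (ENNReal.mul_ne_top (by norm_num)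
    (ENNReal.rpow_ne_top_of_nonneg hq'0.le (by norm_num))) hc20
  set M : ℝ≥0∞ := A * ((C:ℝ≥0∞) ^ q + 1) with hM
  have hMt : M ≠ ⊤ := ENNReal.mul_ne_top hAt (ENNReal.add_ne_top.2
    ⟨ENNReal.rpow_ne_top_of_nonneg hq0.le ENNReal.coe_ne_top, ENNReal.one_ne_top⟩)
  set ε1 : ℝ≥0∞ := ε / (M + 1) with hε1
  have hε10 : 0 < ε1 := ENNReal.div_pos hε.ne' (ENNReal.add_ne_top.2 ⟨hMt, ENNReal.one_ne_top⟩)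
  have hMε : M * ε1 ≤ ε :=
    (mul_le_mul' (le_self_add : M ≤ M + 1) le_rfl).trans ENNReal.mul_div_le
  -- the cover of the image
  obtain ⟨U, hUc, hUd, hUs⟩ : ∃ U : ℕ → Set (ℝ × ℝ), f '' X ⊆ ⋃ n, U n ∧
      (∀ n, ediam (U n) ≤ r) ∧ ∑' n, ⨆ _ : (U n).Nonempty, ediam (U n) ^ q < ε1 := by
    rw [Measure.hausdorffMeasure_apply] at hz
    have h1 := le_iSup₂ (f := fun (r : ℝ≥0∞) (_ : 0 < r) =>
        ⨅ (t : ℕ → Set (ℝ × ℝ)) (_ : f '' X ⊆ ⋃ n, t n) (_ : ∀ n, ediam (t n) ≤ r),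
          ∑' n, ⨆ _ : (t n).Nonempty, ediam (t n) ^ q) r hr0
    rw [hz] at h1
    have h2 := lt_of_le_of_lt h1 hε10
    simp only [iInf_lt_iff] at h2
    obtain ⟨U, h3, h4, h5⟩ := h2
    exact ⟨U, h3, h4, h5⟩
  obtain ⟨δ, hδ0, hδs⟩ := ENNReal.exists_pos_sum_of_countable' hε10.ne' ℕ
  set V : ℕ → Set (ℝ × ℝ) := fun i => f ⁻¹' U i ∩ X with hV
  have hfV : ∀ i, f '' V i ⊆ U i := fun i => by
    rintro _ ⟨p, hp, rfl⟩; exact hp.1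
  have hsq : ∀ i : {i // (V i).Nonempty}, ∃ k m : ℕ, ∃ j : ℤ, m ∈ Finset.range (2 ^ k + 1) ∧
      V i ⊆ Tsq k m j ∧
        ediam (f '' Tsq k m j) ≤ max (C * ediam (f '' V i)) (δ i ^ q⁻¹) := by
    rintro ⟨i, hi⟩
    refine hC (V i) hi (fun p hp => hp.2.1) ?_ _ ?_
    · intro p hp z hz'
      refine hr p hp.2 z hz'.2 ?_
      exact (Metric.edist_le_ediam_of_mem (s := U i) hp.1 hz'.1).trans (hUd i)
    · rw [← ENNReal.zero_rpow_of_pos (inv_pos.2 hq0)]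
      exact ENNReal.rpow_lt_rpow (hδ0 i) (inv_pos.2 hq0)
  choose k m j hm hVT hdT using hsq
  set g : {i // (V i).Nonempty} → ℕ × ℤ × ℕ := fun i => (k i, j i, m i) with hg
  set b : ℕ → ℕ → ℤ → ℝ≥0∞ := fun k m j =>
    if (k, j, m) ∈ range g then ediam (f '' Tsq k m j) else 0 with hb
  have hbsum : ∑' i : ℕ × ℤ × ℕ, b i.1 i.2.2 i.2.1 ^ q ≤ ((C:ℝ≥0∞) ^ q + 1) * ε1 := by
    set F : ℕ × ℤ × ℕ → ℝ≥0∞ := fun i => ediam (f '' Tsq i.1 i.2.2 i.2.1) ^ q with hF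
    calc ∑' i : ℕ × ℤ × ℕ, b i.1 i.2.2 i.2.1 ^ q = ∑' i, (range g).indicator F i := by
          congr 1; ext ⟨k', j', m'⟩
          simp only [hb, hF, Set.indicator]
          split_ifs
          · rfl
          · exact ENNReal.zero_rpow_of_pos hq0
      _ = ∑' i : range g, F i := (tsum_subtype _ _).symm
      _ ≤ ∑' i, F (rangeFactorization g i) :=
          ENNReal.tsum_le_tsum_comp_of_surjective rangeFactorization_surjective
            (fun i : range g => F i)
      _ ≤ ∑' i : {i // (V i).Nonempty},
            ((C:ℝ≥0∞) ^ q * (⨆ _ : (U i).Nonempty, ediam (U i) ^ q) + δ i) := by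
          refine ENNReal.tsum_le_tsum fun i => ?_
          have h1 := ENNReal.rpow_le_rpow (hdT i) hq0.le
          refine h1.trans ?_
          have hne : (U i).Nonempty := i.2.elim fun p hp => ⟨f p, hp.1⟩
          rw [iSup_pos hne]
          rcases le_total (C * ediam (f '' V i)) (δ i ^ q⁻¹) with h | h
          · rw [max_eq_right h, ENNReal.rpow_inv_rpow hq0.ne']
            exact le_add_self
          · rw [max_eq_left h, ENNReal.mul_rpow_of_nonneg _ _ hq0.le]
            refine le_trans ?_ le_self_add
            exact mul_le_mul' le_rfl (ENNReal.rpow_le_rpow (Metric.ediam_mono (hfV i)) hq0.le)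
      _ ≤ ∑' i : ℕ, ((C:ℝ≥0∞) ^ q * (⨆ _ : (U i).Nonempty, ediam (U i) ^ q) + δ i) :=
          ENNReal.tsum_comp_le_tsum_of_injective Subtype.val_injective _
      _ = (C:ℝ≥0∞) ^ q * (∑' i : ℕ, ⨆ _ : (U i).Nonempty, ediam (U i) ^ q) + ∑' i, δ i := by
          rw [ENNReal.tsum_add, ENNReal.tsum_mul_left]
      _ ≤ (C:ℝ≥0∞) ^ q * ε1 + ε1 := add_le_add (mul_le_mul' le_rfl hUs.le) hδs.le
      _ = _ := by ring
  refine ⟨_, ?_, (cover_sum q q' (by linarith) c2 hc20 hc2t b).trans ?_⟩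
  · rintro ⟨x, y⟩ ⟨hx, hy⟩
    have hline := line_sum hfc y b (by
      intro x' hx'
      have hp : (x', y) ∈ X := ⟨hx', hy⟩
      obtain ⟨i, hi⟩ := mem_iUnion.1 (hUc (mem_image_of_mem f hp))
      have hpV : (x', y) ∈ V i := ⟨hi, hp⟩
      let i' : {i // (V i).Nonempty} := ⟨i, ⟨_, hpV⟩⟩
      refine ⟨k i', m i', hm i', j i', hVT i' hpV, ?_⟩
      have : (k i', j i', m i') ∈ range g := ⟨i', rfl⟩
      simp only [hb]
      rw [if_pos this])
    obtain ⟨k', o, ho, hgood⟩ := hpig b y ((hmin hy).trans hline)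
    obtain ⟨m', hm', hxy⟩ := Tsq_cover (k := k') (y := y) hx.1 hx.2 ho
    refine mem_iUnion.2 ⟨(k', ⌊y * 2 ^ k'⌋ + o, m'), ?_⟩
    rw [if_pos ⟨hgood, hm'⟩]
    exact hxy
  · calc A * ∑' i : ℕ × ℤ × ℕ, b i.1 i.2.2 i.2.1 ^ q ≤ A * (((C:ℝ≥0∞) ^ q + 1) * ε1) :=
          mul_le_mul' le_rfl hbsum
      _ = M * ε1 := by rw [hM, mul_assoc]
      _ ≤ ε := hMε

end QSProof

theorem stmt19 (B : Set ℝ) (hB : IsCompact B) (hBne : B.Nonempty)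
    (hBbox : 0 < lowerBoxDim B)
    (f : Homeomorph (ℝ × ℝ) (ℝ × ℝ)) (hf : IsQuasisymmetry ⇑f) :
    dimH (Set.Icc (0:ℝ) 1 ×ˢ B) ≤ dimH (⇑f '' (Set.Icc (0:ℝ) 1 ×ˢ B)) := by
  by_contra! hlt
  obtain ⟨y0, hy0⟩ := hBne
  have h1 : 1 ≤ dimH (⇑f '' (Set.Icc (0:ℝ) 1 ×ˢ B)) :=
    QSProof.one_le_dim f.continuous f.injective _ y0 (fun x hx => ⟨hx, hy0⟩)
  obtain ⟨q, hq1, hq2⟩ := ENNReal.lt_iff_exists_nnreal_btwn.1 hlt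
  obtain ⟨q', hq3, hq4⟩ := ENNReal.lt_iff_exists_nnreal_btwn.1 hq2
  have hz := hausdorffMeasure_of_dimH_lt hq1
  have ht := hausdorffMeasure_of_lt_dimH hq4
  have hq : (1:ℝ) ≤ q := by
    have : (1:ENNReal) ≤ q := h1.trans hq1.le
    exact_mod_cast this
  have := QSProof.main_zero B hB ⟨y0, hy0⟩ f hf q q' hq (by exact_mod_cast hq3) hz
  rw [this] at ht
  exact ENNReal.zero_ne_top ht
end
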